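/- Early-abandoning validity: for any window size W ≥ 0 and any integer V with 1 ≤ V ≤ L/2, the partial sum over only the left and right bands is already a lower bound: Σ_{i=1}^{V} min_{(j,k)∈ℒ^W_i} δ(A_j,B_k) + Σ_{i=L−V+1}^{L} min_{(j,k)∈ℛ^W_i} δ(A_j,B_k) ≤ DTW²_W(A,B). -/

import Mathlib

noncomputable section

/-- Squared pointwise cost. -/
def delta (x y : ℝ) : ℝ := (x - y) ^ 2

/-- Continuity/monotonicity step of a warping path. -/
def Step (q r : ℕ × ℕ) : Prop :=
  r = (q.1 + 1, q.2) ∨ r = (q.1, q.2 + 1) ∨ r = (q.1 + 1, q.2 + 1)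

/-- A `W`-warping path for series of length `L` (1-based indices). -/
def IsWarpingPath (L W : ℕ) (p : List (ℕ × ℕ)) : Prop :=
  p.head? = some (1, 1) ∧ p.getLast? = some (L, L) ∧ List.Chain' Step p ∧
    ∀ q ∈ p, 1 ≤ q.1 ∧ q.1 ≤ L ∧ 1 ≤ q.2 ∧ q.2 ≤ L ∧ ((q.1 : ℤ) - (q.2 : ℤ)).natAbs ≤ W

/-- Cost of a warping path. -/
def pathCost (A B : ℕ → ℝ) (p : List (ℕ × ℕ)) : ℝ :=
  (p.map (fun q => delta (A q.1) (B q.2))).sum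

/-- `DTW²_W(A,B)`: minimum cost over all `W`-warping paths. -/
def DTW2 (L W : ℕ) (A B : ℕ → ℝ) : ℝ :=
  sInf (pathCost A B '' {p | IsWarpingPath L W p})

/-- Left band `ℒ^W_i`. -/
def leftBand (W i : ℕ) : Finset (ℕ × ℕ) :=
  (Finset.Icc (max 1 (i - W)) i).image (fun j => (j, i)) ∪
    (Finset.Icc (max 1 (i - W)) i).image (fun k => (i, k))

/-- Right band `ℛ^W_i`. -/
def rightBand (L W i : ℕ) : Finset (ℕ × ℕ) :=
  (Finset.Icc i (min L (i + W))).image (fun j => (j, i)) ∪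
    (Finset.Icc i (min L (i + W))).image (fun k => (i, k))

/-- Vertical band `𝒱_i`. -/
def vertBand (L W i : ℕ) : Finset (ℕ × ℕ) :=
  (Finset.Icc (max 1 (i - W)) (min L (i + W))).image (fun j => (i, j))

/-- Minimum of `δ(A_j, B_k)` over a (finite, nonempty) band of pairs `(j,k)`. -/
def bandMin (A B : ℕ → ℝ) (s : Finset (ℕ × ℕ)) : ℝ :=
  sInf ((fun q => delta (A q.1) (B q.2)) '' (s : Set (ℕ × ℕ)))

/-- Upper envelope `𝕌^B_i`. -/
def upperEnv (L W : ℕ) (B : ℕ → ℝ) (i : ℕ) : ℝ :=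
  sSup (B '' Set.Icc (max 1 (i - W)) (min L (i + W)))

/-- Lower envelope `𝕃^B_i`. -/
def lowerEnv (L W : ℕ) (B : ℕ → ℝ) (i : ℕ) : ℝ :=
  sInf (B '' Set.Icc (max 1 (i - W)) (min L (i + W)))

/-- LB_Keogh term `κ_i`. -/
def kappa (L W : ℕ) (A B : ℕ → ℝ) (i : ℕ) : ℝ :=
  if upperEnv L W B i < A i then delta (A i) (upperEnv L W B i)
  else if A i < lowerEnv L W B i then delta (A i) (lowerEnv L W B i)
  else 0

theorem delta_nonneg (x y : ℝ) : 0 ≤ delta x y := sq_nonneg _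

theorem bandMin_le (A B : ℕ → ℝ) {s : Finset (ℕ × ℕ)} {q : ℕ × ℕ} (hq : q ∈ s) :
    bandMin A B s ≤ delta (A q.1) (B q.2) := by
  refine csInf_le ⟨0, ?_⟩ ⟨q, hq, rfl⟩
  rintro _ ⟨r, -, rfl⟩
  exact delta_nonneg _ _

theorem mem_leftBand {W i : ℕ} {q : ℕ × ℕ} (h1 : 1 ≤ q.1) (h2 : 1 ≤ q.2)
    (hW : ((q.1 : ℤ) - (q.2 : ℤ)).natAbs ≤ W) (hi : max q.1 q.2 = i) :
    q ∈ leftBand W i := by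
  obtain ⟨j, k⟩ := q
  simp only [leftBand, Finset.mem_union, Finset.mem_image, Finset.mem_Icc, Prod.mk.injEq]
  dsimp only at *
  rcases le_total j k with h | h
  · exact Or.inl ⟨j, by omega, rfl, by omega⟩
  · exact Or.inr ⟨k, by omega, by omega, rfl⟩

theorem mem_rightBand {L W i : ℕ} {q : ℕ × ℕ} (h1 : q.1 ≤ L) (h2 : q.2 ≤ L)
    (hW : ((q.1 : ℤ) - (q.2 : ℤ)).natAbs ≤ W) (hi : min q.1 q.2 = i) :
    q ∈ rightBand L W i := by
  obtain ⟨j, k⟩ := q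
  simp only [rightBand, Finset.mem_union, Finset.mem_image, Finset.mem_Icc, Prod.mk.injEq]
  dsimp only at *
  rcases le_total j k with h | h
  · exact Or.inr ⟨k, by omega, by omega, rfl⟩
  · exact Or.inl ⟨j, by omega, rfl, by omega⟩

/-- Discrete intermediate value theorem along a chain on which `g` grows by at most one
per step. -/
theorem List.IsChain.exists_mem_eq {α : Type*} {R : α → α → Prop} {g : α → ℕ}
    (hg : ∀ q r, R q r → g r ≤ g q + 1) {i : ℕ} {b : α} (hb : i ≤ g b) :
    ∀ {p : List α} {a : α}, p.IsChain R → p.head? = some a → p.getLast? = some b →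
      g a ≤ i → ∃ q ∈ p, g q = i
  | [], _, _, h, _, _ => by simp at h
  | [x], a, _, h, h', hi => by
    simp only [List.head?_cons, List.getLast?_singleton, Option.some.injEq] at h h'
    subst h h'
    exact ⟨x, by simp, by omega⟩
  | x :: y :: l, a, hc, h, h', hi => by
    simp only [List.head?_cons, Option.some.injEq] at h
    subst h
    rw [List.isChain_cons_cons] at hc
    rcases hi.eq_or_lt with he | hlt
    · exact ⟨x, by simp, he⟩
    · obtain ⟨q, hq, hqi⟩ := List.IsChain.exists_mem_eq hg hb hc.2 (a := y) (by simp)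
        (by simpa [List.getLast?_cons_cons] using h') (by have := hg x y hc.1; omega)
      exact ⟨q, List.mem_cons_of_mem _ hq, hqi⟩

theorem Finset.sum_le_list_sum_map {α : Type*} [DecidableEq α] {f : α → ℝ}
    (hf : ∀ a, 0 ≤ f a) : ∀ (p : List α) (s : Finset α), (∀ a ∈ s, a ∈ p) →
      ∑ a ∈ s, f a ≤ (p.map f).sum
  | [], s, h => by
    have : s = ∅ := Finset.eq_empty_of_forall_notMem fun a ha => by simpa using h a ha
    simp [this]
  | x :: l, s, h => by
    have ih := Finset.sum_le_list_sum_map hf l (s.erase x) fun a ha => by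
      rw [Finset.mem_erase] at ha
      exact (List.mem_cons.1 (h a ha.2)).resolve_left ha.1
    rw [List.map_cons, List.sum_cons]
    by_cases hx : x ∈ s
    · rw [← Finset.add_sum_erase s f hx]
      gcongr
    · rw [Finset.erase_eq_of_notMem hx] at ih
      linarith [hf x]

theorem exists_isWarpingPath {L : ℕ} (W : ℕ) (hL : 1 ≤ L) : ∃ p, IsWarpingPath L W p := by
  obtain ⟨n, rfl⟩ : ∃ n, L = n + 1 := ⟨L - 1, by omega⟩
  refine ⟨(List.range (n + 1)).map fun k => (k + 1, k + 1), ?_, ?_, ?_, ?_⟩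
  · simp [List.range_succ_eq_map]
  · simp [List.range_succ]
  · change List.IsChain Step _
    rw [List.isChain_map]
    refine (List.isChain_range_succ _ n).2 fun m _ => ?_
    exact Or.inr (Or.inr rfl)
  · simp only [List.mem_map, List.mem_range]
    rintro _ ⟨k, hk, rfl⟩
    dsimp only
    omega

/-- Early-abandoning validity: the partial sum over only the left and right bands is
already a lower bound on `DTW²_W(A,B)`. -/
theorem lbEnhanced_partial_lower_bound (L W V : ℕ) (hL : 1 ≤ L)
    (hV1 : 1 ≤ V) (hV2 : 2 * V ≤ L) (A B : ℕ → ℝ) :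
    (∑ i ∈ Finset.Icc 1 V, bandMin A B (leftBand W i)) +
      (∑ i ∈ Finset.Icc (L - V + 1) L, bandMin A B (rightBand L W i)) ≤
    DTW2 L W A B := by
  refine le_csInf (Set.Nonempty.image _ (exists_isWarpingPath W hL)) ?_
  rintro _ ⟨p, ⟨hhead, hlast, hchain, hmem⟩, rfl⟩
  have hmax : ∀ i ∈ Finset.Icc 1 V, ∃ q ∈ p, max q.1 q.2 = i := fun i hi => by
    rw [Finset.mem_Icc] at hi
    refine List.IsChain.exists_mem_eq (g := fun q : ℕ × ℕ => max q.1 q.2) ?_ ?_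
      hchain hhead hlast ?_
    · rintro q r (rfl | rfl | rfl) <;> dsimp only <;> omega
    · dsimp only; omega
    · dsimp only; omega
  have hmin : ∀ i ∈ Finset.Icc (L - V + 1) L, ∃ q ∈ p, min q.1 q.2 = i := fun i hi => by
    rw [Finset.mem_Icc] at hi
    refine List.IsChain.exists_mem_eq (g := fun q : ℕ × ℕ => min q.1 q.2) ?_ ?_
      hchain hhead hlast ?_
    · rintro q r (rfl | rfl | rfl) <;> dsimp only <;> omega
    · dsimp only; omega
    · dsimp only; omega
  choose! u hup hu using hmax
  choose! v hvp hv using hmin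
  have hdisj : Disjoint ((Finset.Icc 1 V).image u) ((Finset.Icc (L - V + 1) L).image v) := by
    simp only [Finset.disjoint_left, Finset.mem_image]
    rintro _ ⟨i, hi, rfl⟩ ⟨j, hj, hij⟩
    have h1 := hu i hi
    have h2 := hv j hj
    rw [hij] at h2
    rw [Finset.mem_Icc] at hi hj
    omega
  calc
    _ ≤ (∑ i ∈ Finset.Icc 1 V, delta (A (u i).1) (B (u i).2)) +
        ∑ i ∈ Finset.Icc (L - V + 1) L, delta (A (v i).1) (B (v i).2) := by
      gcongr with i hi i hi
      · obtain ⟨h1, -, h2, -, hW⟩ := hmem _ (hup i hi)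
        exact bandMin_le A B (mem_leftBand h1 h2 hW (hu i hi))
      · obtain ⟨-, h1, -, h2, hW⟩ := hmem _ (hvp i hi)
        exact bandMin_le A B (mem_rightBand h1 h2 hW (hv i hi))
    _ = ∑ q ∈ (Finset.Icc 1 V).image u ∪ (Finset.Icc (L - V + 1) L).image v,
        delta (A q.1) (B q.2) := by
      rw [Finset.sum_union hdisj, Finset.sum_image, Finset.sum_image]
      · intro i hi j hj h
        rw [← hv i hi, ← hv j hj, h]
      · intro i hi j hj h
        rw [← hu i hi, ← hu j hj, h]
    _ ≤ pathCost A B p := by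
      refine Finset.sum_le_list_sum_map (fun q => delta_nonneg _ _) p _ fun q hq => ?_
      simp only [Finset.mem_union, Finset.mem_image] at hq
      rcases hq with ⟨i, hi, rfl⟩ | ⟨i, hi, rfl⟩
      · exact hup i hi
      · exact hvp i hi
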